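/- Let N, q ≥ 1, let α, β be reals with 0 < α < 1 < 1/α < β, let μ₁, μ₂, μ₃ > 0, let k₁,…,k_N be reals with 0 < k_i ≤ k_M for all i, and let ς₁,…,ς_N ∈ ℝ^q. Define V = Σ_{i=1}^N k_i( (μ₁/2)Σ_{j=1}^q ς_{ij}² + (μ₂/(α+1))Σ_{j=1}^q |ς_{ij}|^{α+1} + (μ₃/(β+1))Σ_{j=1}^q |ς_{ij}|^{β+1} ) and s = Σ_{i=1}^N Σ_{j=1}^q ς_{ij}². Then V^{2α/(α+1)} ≤ c₄(s^β + 3s^α + s), where c₄ = max{ (μ₁k_M/2)^{2α/(α+1)}(Nq)^{(1−α)/(α+1)}, (μ₂k_M/(α+1))^{2α/(α+1)}(Nq)^{1−α}, (μ₃k_M/(β+1))^{2α/(α+1)} }. -/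

import Mathlib

theorem aux_between {s a e b : ℝ} (hs : 0 ≤ s) (ha : 0 < a) (h1 : a ≤ e) (h2 : e ≤ b) :
    s ^ e ≤ s ^ a + s ^ b := by
  have A := Real.rpow_nonneg hs a
  have B := Real.rpow_nonneg hs b
  rcases le_total s 1 with h | h
  · have := Real.rpow_le_rpow_of_exponent_ge_of_imp hs h h1 (by intro _ h0; linarith)
    linarith
  · have := Real.rpow_le_rpow_of_exponent_le h h2
    linarith

theorem aux_super {ι : Type*} [Fintype ι] (x : ι → ℝ) (hx : ∀ i, 0 ≤ x i) {r : ℝ} (hr : 1 ≤ r) :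
    ∑ i, x i ^ r ≤ (∑ i, x i) ^ r := by
  have key : ∀ y : ℝ, 0 ≤ y → y ^ r = y * y ^ (r - 1) := by
    intro y hy
    nth_rewrite 2 [← Real.rpow_one y]
    rw [← Real.rpow_add' hy (by linarith)]
    congr 1; ring
  have hs : 0 ≤ ∑ i, x i := Finset.sum_nonneg fun i _ => hx i
  rw [key _ hs, Finset.sum_mul]
  refine Finset.sum_le_sum fun i _ => ?_
  rw [key _ (hx i)]
  refine mul_le_mul_of_nonneg_left ?_ (hx i)
  exact Real.rpow_le_rpow (hx i) (Finset.single_le_sum (fun j _ => hx j) (Finset.mem_univ i))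
    (by linarith)

theorem aux_sq (y r : ℝ) : (y ^ 2) ^ (r / 2) = |y| ^ r := by
  rw [← sq_abs, ← Real.rpow_natCast, ← Real.rpow_mul (abs_nonneg y)]
  congr 1; push_cast; ring

theorem aux_main {ι : Type*} [Fintype ι] (n : ℝ) (hn : n = Fintype.card ι) (hn1 : 1 ≤ n)
    (y : ι → ℝ) (α β A B C V s : ℝ) (hα0 : 0 < α) (hα1 : α < 1) (hαβ : 1 / α < β)
    (hA : 0 ≤ A) (hB : 0 ≤ B) (hC : 0 ≤ C) (hV0 : 0 ≤ V) (hs : s = ∑ i, y i ^ 2)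
    (hV : V ≤ A * s + B * ∑ i, |y i| ^ (α + 1) + C * ∑ i, |y i| ^ (β + 1)) :
    V ^ (2 * α / (α + 1)) ≤
      max (max (A ^ (2 * α / (α + 1)) * n ^ ((1 - α) / (α + 1)))
            (B ^ (2 * α / (α + 1)) * n ^ (1 - α)))
          (C ^ (2 * α / (α + 1))) * (s ^ β + 3 * s ^ α + s) := by
  have hβ : 1 < β := lt_trans (by rw [lt_div_iff₀ hα0]; linarith) hαβ
  have hαβ' : 1 < β * α := by rwa [div_lt_iff₀ hα0] at hαβ
  have hs0 : 0 ≤ s := by rw [hs]; positivity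
  have hSa0 : 0 ≤ ∑ i, |y i| ^ (α + 1) := by positivity
  have hSb0 : 0 ≤ ∑ i, |y i| ^ (β + 1) := by positivity
  set Sa := ∑ i, |y i| ^ (α + 1) with hSa
  set Sb := ∑ i, |y i| ^ (β + 1) with hSb
  set p := 2 * α / (α + 1) with hp
  have hp0 : 0 < p := by positivity
  have hp1 : p ≤ 1 := by rw [hp, div_le_one (by linarith)]; linarith
  have hpα : α ≤ p := by rw [hp, le_div_iff₀ (by linarith)]; nlinarith
  have h1 : V ^ p ≤ A ^ p * s ^ p + B ^ p * Sa ^ p + C ^ p * Sb ^ p := by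
    rw [← Real.mul_rpow hA hs0, ← Real.mul_rpow hB hSa0, ← Real.mul_rpow hC hSb0]
    refine (Real.rpow_le_rpow hV0 hV hp0.le).trans ?_
    refine (Real.rpow_add_le_add_rpow (by positivity) (by positivity) hp0.le hp1).trans ?_
    gcongr
    exact Real.rpow_add_le_add_rpow (by positivity) (by positivity) hp0.le hp1
  have hsp : s ^ p ≤ s ^ α + s := by
    simpa using aux_between hs0 hα0 hpα hp1
  have hSbp : Sb ^ p ≤ s ^ α + s ^ β := by
    have h : Sb ≤ s ^ ((β + 1) / 2) := by
      rw [hSb, hs]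
      simp_rw [← aux_sq]
      exact aux_super _ (fun i => sq_nonneg _) (by linarith)
    refine (Real.rpow_le_rpow hSb0 h hp0.le).trans ?_
    rw [← Real.rpow_mul hs0]
    have e : (β + 1) / 2 * p = α * (β + 1) / (α + 1) := by rw [hp]; field_simp
    rw [e]
    apply aux_between hs0 hα0
    · rw [le_div_iff₀ (by linarith)]; nlinarith
    · rw [div_le_iff₀ (by linarith)]; nlinarith
  have hSap : Sa ^ p ≤ n ^ (1 - α) * s ^ α := by
    have h := Real.rpow_sum_le_const_mul_sum_rpow (Finset.univ : Finset ι)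
      (fun i => |y i| ^ (α + 1)) (p := 2 / (α + 1))
      (by rw [le_div_iff₀ (by linarith)]; linarith)
    have e2 : ∀ i, |(|y i| ^ (α + 1))| ^ (2 / (α + 1)) = y i ^ 2 := by
      intro i
      rw [abs_of_nonneg (by positivity), ← Real.rpow_mul (abs_nonneg _),
        mul_div_cancel₀ _ (by linarith : α + 1 ≠ 0)]
      rw [Real.rpow_two, sq_abs]
    have e3 : ∀ i, |(|y i| ^ (α + 1))| = |y i| ^ (α + 1) := fun i =>
      abs_of_nonneg (by positivity)
    simp_rw [e2, e3] at h
    rw [← hSa, ← hs, Finset.card_univ, ← hn] at h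
    have e4 : Sa ^ p = (Sa ^ (2 / (α + 1))) ^ α := by
      rw [← Real.rpow_mul hSa0]; congr 1; rw [hp]; ring
    rw [e4]
    refine (Real.rpow_le_rpow (by positivity) h hα0.le).trans ?_
    rw [Real.mul_rpow (by positivity) hs0, ← Real.rpow_mul (by linarith)]
    gcongr
    · have : (2 / (α + 1) - 1) = (1 - α) / (α + 1) := by field_simp; ring
      rw [this, div_mul_eq_mul_div, div_le_iff₀ (by linarith)]
      nlinarith
  set c := max (max (A ^ p * n ^ ((1 - α) / (α + 1))) (B ^ p * n ^ (1 - α))) (C ^ p) with hc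
  have cA : A ^ p ≤ c := by
    refine le_trans ?_ ((le_max_left _ _).trans (le_max_left _ _))
    refine le_mul_of_one_le_right (by positivity) (Real.one_le_rpow hn1 ?_)
    exact div_nonneg (by linarith) (by linarith)
  have cB : B ^ p * n ^ (1 - α) ≤ c := (le_max_right _ _).trans (le_max_left _ _)
  have cC : C ^ p ≤ c := le_max_right _ _
  have hc0 : 0 ≤ c := le_trans (by positivity) cC
  have t1 : A ^ p * s ^ p ≤ c * (s ^ α + s) := by gcongr
  have t3 : C ^ p * Sb ^ p ≤ c * (s ^ α + s ^ β) := by gcongr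
  have t2 : B ^ p * Sa ^ p ≤ c * s ^ α := by
    calc B ^ p * Sa ^ p ≤ B ^ p * (n ^ (1 - α) * s ^ α) := by gcongr
      _ = B ^ p * n ^ (1 - α) * s ^ α := by ring
      _ ≤ _ := by gcongr
  linarith

/-- the bound `V^(2α/(α+1)) ≤ c₄ (s^β + 3 s^α + s)` for the
Lyapunov function `V`, where `s` is the squared norm of the stacked vector. -/
theorem stmt_10 (N q : ℕ) (hN : 1 ≤ N) (hq : 1 ≤ q)
    (α β μ₁ μ₂ μ₃ kM : ℝ) (hα0 : 0 < α) (hα1 : α < 1) (hαβ : 1 / α < β)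
    (hμ₁ : 0 < μ₁) (hμ₂ : 0 < μ₂) (hμ₃ : 0 < μ₃)
    (k : Fin N → ℝ) (hk : ∀ i, 0 < k i) (hkM : ∀ i, k i ≤ kM)
    (ς : Fin N → Fin q → ℝ) :
    (∑ i, k i * ((μ₁ / 2) * ∑ j, (ς i j) ^ 2
        + (μ₂ / (α + 1)) * ∑ j, |ς i j| ^ (α + 1)
        + (μ₃ / (β + 1)) * ∑ j, |ς i j| ^ (β + 1)) : ℝ) ^ (2 * α / (α + 1)) ≤
      max (max ((μ₁ * kM / 2 : ℝ) ^ (2 * α / (α + 1)) * ((N * q : ℕ) : ℝ) ^ ((1 - α) / (α + 1)))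
            ((μ₂ * kM / (α + 1) : ℝ) ^ (2 * α / (α + 1)) * ((N * q : ℕ) : ℝ) ^ (1 - α)))
          ((μ₃ * kM / (β + 1) : ℝ) ^ (2 * α / (α + 1))) *
        ((∑ i, ∑ j, (ς i j) ^ 2 : ℝ) ^ β + 3 * (∑ i, ∑ j, (ς i j) ^ 2 : ℝ) ^ α
          + (∑ i, ∑ j, (ς i j) ^ 2)) := by
  have hβ : 0 < β := lt_trans (by positivity) hαβ
  have hkM0 : 0 < kM := (hk ⟨0, hN⟩).trans_le (hkM ⟨0, hN⟩)
  have hn1 : (1 : ℝ) ≤ ((N * q : ℕ) : ℝ) := by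
    exact_mod_cast Nat.mul_pos hN hq
  refine aux_main (ι := Fin N × Fin q) _ (by simp) hn1 (fun x => ς x.1 x.2) α β _ _ _ _ _
    hα0 hα1 hαβ (by positivity) (by positivity) (by positivity) ?_ ?_ ?_
  · refine Finset.sum_nonneg fun i _ => mul_nonneg (hk i).le (by positivity)
  · rw [Fintype.sum_prod_type]
  · rw [Fintype.sum_prod_type, Fintype.sum_prod_type, Finset.mul_sum, Finset.mul_sum,
      Finset.mul_sum, ← Finset.sum_add_distrib, ← Finset.sum_add_distrib]
    refine Finset.sum_le_sum fun i _ => ?_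
    refine (mul_le_mul_of_nonneg_right (hkM i) (by positivity)).trans (le_of_eq ?_)
    ring
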